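/- Let G be a finite group and let [A_1, ..., A_r] be a logarithmic signature for G. If each block A_j (1 ≤ j ≤ r) admits a minimal logarithmic signature as a subset of G, then G admits a minimal logarithmic signature. -/

import Mathlib

/-- The product map of a sequence of blocks: `(a₁, …, aₛ) ↦ a₁ ⋯ aₛ`. -/
def lsProd {G : Type*} [Group G] {s : ℕ} (A : Fin s → Finset G)
    (a : ∀ i, (A i : Finset G)) : G :=
  (List.ofFn fun i => ((a i : G))).prod

/-- The length of a sequence of blocks: the sum of their cardinalities. -/
def lsLength {G : Type*} [Group G] {s : ℕ} (A : Fin s → Finset G) : ℕ :=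
  ∑ i, (A i).card

/-- The minimal possible length `Σ aⱼ pⱼ` for a set of size `n = ∏ pⱼ^{aⱼ}`. -/
def lsTarget (n : ℕ) : ℕ :=
  n.factorization.sum fun p a => a * p

/-- `A` is a logarithmic signature for the group `G`: the product map is a bijection. -/
def IsLS {G : Type*} [Group G] {s : ℕ} (A : Fin s → Finset G) : Prop :=
  Function.Bijective (lsProd A)

/-- `B` is a logarithmic signature for the finite subset `S` of `G`:
the product map is injective with image exactly `S`. -/
def IsLSFor {G : Type*} [Group G] (S : Finset G) {t : ℕ} (B : Fin t → Finset G) : Prop :=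
  Function.Injective (lsProd B) ∧ ∀ g : G, g ∈ S ↔ ∃ b, lsProd B b = g

/-- The group `G` admits a minimal logarithmic signature. -/
def HasMLS (G : Type*) [Group G] : Prop :=
  ∃ (s : ℕ) (A : Fin s → Finset G), IsLS A ∧ lsLength A = lsTarget (Nat.card G)

/-- The finite subset `S` of `G` admits a minimal logarithmic signature. -/
def HasMLSFor {G : Type*} [Group G] (S : Finset G) : Prop :=
  ∃ (t : ℕ) (B : Fin t → Finset G), IsLSFor S B ∧ lsLength B = lsTarget S.card

/-- The finite set `S` is the direct product of `A` and `T`: every element of `S` is uniquely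
a product of an element of `A` and an element of `T`. -/
def IsDirectProd {G : Type*} [Group G] (A T S : Finset G) : Prop :=
  Set.BijOn (fun p : G × G => p.1 * p.2) ((A : Set G) ×ˢ (T : Set G)) S

theorem isDirectProd_iff {G : Type*} [Group G] {A T S : Finset G} :
    IsDirectProd A T S ↔
      (∀ a ∈ A, ∀ t ∈ T, ∀ a' ∈ A, ∀ t' ∈ T, a * t = a' * t' → a = a' ∧ t = t') ∧
        ∀ g, g ∈ S ↔ ∃ a ∈ A, ∃ t ∈ T, a * t = g := by
  constructor
  · rintro ⟨hm, hi, hs⟩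
    refine ⟨fun a ha t ht a' ha' t' ht' h => ?_, fun g => ⟨fun hg => ?_, ?_⟩⟩
    · have := hi (x₁ := (a, t)) (x₂ := (a', t')) ⟨ha, ht⟩ ⟨ha', ht'⟩ h
      simpa using this
    · obtain ⟨⟨a, t⟩, ⟨ha, ht⟩, h⟩ := hs hg
      exact ⟨a, ha, t, ht, h⟩
    · rintro ⟨a, ha, t, ht, rfl⟩
      exact hm (x := (a, t)) ⟨ha, ht⟩
  · rintro ⟨hi, hs⟩
    refine ⟨?_, ?_, ?_⟩
    · rintro ⟨a, t⟩ ⟨ha, ht⟩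
      exact (hs _).2 ⟨a, ha, t, ht, rfl⟩
    · rintro ⟨a, t⟩ ⟨ha, ht⟩ ⟨a', t'⟩ ⟨ha', ht'⟩ h
      exact Prod.ext_iff.2 (hi a ha t ht a' ha' t' ht' h)
    · intro g hg
      obtain ⟨a, ha, t, ht, h⟩ := (hs g).1 hg
      exact ⟨(a, t), ⟨ha, ht⟩, h⟩

theorem IsDirectProd.card {G : Type*} [Group G] {A T S : Finset G} (h : IsDirectProd A T S) :
    S.card = A.card * T.card := by
  rw [← Finset.card_product]
  symm
  refine Finset.card_bij (fun p _ => p.1 * p.2) (fun p hp => ?_) (fun p hp q hq => ?_)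
    fun g hg => ?_
  · exact h.mapsTo (by simpa using hp)
  · exact h.injOn (by simpa using hp) (by simpa using hq)
  · obtain ⟨p, hp, hpg⟩ := h.surjOn hg
    exact ⟨p, by simpa using hp, hpg⟩

theorem IsDirectProd.assoc {G : Type*} [Group G] {A T S U R : Finset G}
    (h : IsDirectProd A T S) (h' : IsDirectProd S U R) (hA : A.Nonempty) :
    ∃ V, IsDirectProd T U V ∧ IsDirectProd A V R := by
  classical
  rw [isDirectProd_iff] at h h'
  obtain ⟨hi, hs⟩ := h
  obtain ⟨hi', hs'⟩ := h'
  have key : ∀ a ∈ A, ∀ t ∈ T, ∀ u ∈ U, ∀ a' ∈ A, ∀ t' ∈ T, ∀ u' ∈ U,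
      a * (t * u) = a' * (t' * u') → a = a' ∧ t = t' ∧ u = u' := by
    intro a ha t ht u hu a' ha' t' ht' u' hu' e
    rw [← mul_assoc, ← mul_assoc] at e
    obtain ⟨e₁, e₂⟩ := hi' _ ((hs _).2 ⟨a, ha, t, ht, rfl⟩) u hu _
      ((hs _).2 ⟨a', ha', t', ht', rfl⟩) u' hu' e
    obtain ⟨e₃, e₄⟩ := hi a ha t ht a' ha' t' ht' e₁
    exact ⟨e₃, e₄, e₂⟩
  have hV : ∀ g, g ∈ (T ×ˢ U).image (fun p => p.1 * p.2) ↔ ∃ t ∈ T, ∃ u ∈ U, t * u = g := by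
    intro g
    simp only [Finset.mem_image, Finset.mem_product, Prod.exists]
    grind
  obtain ⟨a₀, ha₀⟩ := hA
  refine ⟨_, isDirectProd_iff.2 ⟨fun t ht u hu t' ht' u' hu' e => ?_, hV⟩,
    isDirectProd_iff.2 ⟨fun a ha v hv a' ha' v' hv' e => ?_, fun g => ⟨fun hg => ?_, ?_⟩⟩⟩
  · exact (key a₀ ha₀ t ht u hu a₀ ha₀ t' ht' u' hu' (by rw [e])).2
  · obtain ⟨t, ht, u, hu, rfl⟩ := (hV _).1 hv
    obtain ⟨t', ht', u', hu', rfl⟩ := (hV _).1 hv'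
    obtain ⟨rfl, rfl, rfl⟩ := key a ha t ht u hu a' ha' t' ht' u' hu' e
    exact ⟨rfl, rfl⟩
  · obtain ⟨s, hsS, u, hu, rfl⟩ := (hs' g).1 hg
    obtain ⟨a, ha, t, ht, rfl⟩ := (hs s).1 hsS
    exact ⟨a, ha, t * u, (hV _).2 ⟨t, ht, u, hu, rfl⟩, (mul_assoc _ _ _).symm⟩
  · rintro ⟨a, ha, v, hv, rfl⟩
    obtain ⟨t, ht, u, hu, rfl⟩ := (hV _).1 hv
    exact (hs' _).2 ⟨a * t, (hs _).2 ⟨a, ha, t, ht, rfl⟩, u, hu, mul_assoc _ _ _⟩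

theorem lsProd_zero {G : Type*} [Group G] (B : Fin 0 → Finset G) (b : ∀ i, B i) :
    lsProd B b = 1 := by
  simp [lsProd]

theorem lsProd_succ {G : Type*} [Group G] {t : ℕ} (B : Fin (t + 1) → Finset G) (b : ∀ i, B i) :
    lsProd B b = b 0 * lsProd (fun i : Fin t => B i.succ) (fun i => b i.succ) := by
  simp [lsProd, List.ofFn_succ]

theorem lsLength_succ {G : Type*} [Group G] {t : ℕ} (B : Fin (t + 1) → Finset G) :
    lsLength B = (B 0).card + lsLength fun i : Fin t => B i.succ :=
  Fin.sum_univ_succ _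

theorem isLSFor_zero {G : Type*} [Group G] {S : Finset G} {B : Fin 0 → Finset G} :
    IsLSFor S B ↔ S = {1} := by
  constructor
  · rintro ⟨-, h⟩
    ext g
    rw [h, Finset.mem_singleton]
    exact ⟨fun ⟨b, hb⟩ => by rw [← hb, lsProd_zero], fun hg => ⟨finZeroElim, by
      rw [lsProd_zero, hg]⟩⟩
  · rintro rfl
    refine ⟨fun b b' _ => Subsingleton.elim _ _, fun g => ?_⟩
    rw [Finset.mem_singleton]
    exact ⟨fun hg => ⟨finZeroElim, by rw [lsProd_zero, hg]⟩, fun ⟨b, hb⟩ => by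
      rw [← hb, lsProd_zero]⟩

theorem IsLSFor.of_tail {G : Type*} [Group G] {t : ℕ} {B : Fin (t + 1) → Finset G}
    {T S : Finset G} (hT : IsLSFor T fun i : Fin t => B i.succ)
    (h : IsDirectProd (B 0) T S) : IsLSFor S B := by
  rw [isDirectProd_iff] at h
  refine ⟨fun b b' e => ?_, fun g => ⟨fun hg => ?_, ?_⟩⟩
  · rw [lsProd_succ, lsProd_succ] at e
    obtain ⟨e₁, e₂⟩ := h.1 _ (b 0).2 _ ((hT.2 _).2 ⟨_, rfl⟩) _ (b' 0).2 _
      ((hT.2 _).2 ⟨_, rfl⟩) e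
    have e₃ := hT.1 e₂
    funext i
    refine Fin.cases (Subtype.ext e₁) (fun i => ?_) i
    exact congrFun e₃ i
  · obtain ⟨a, ha, s, hs, rfl⟩ := (h.2 g).1 hg
    obtain ⟨c, rfl⟩ := (hT.2 s).1 hs
    refine ⟨Fin.cons (α := fun i => B i) ⟨a, ha⟩ c, ?_⟩
    rw [lsProd_succ]
    rfl
  · rintro ⟨b, rfl⟩
    rw [lsProd_succ]
    exact (h.2 _).2 ⟨_, (b 0).2, _, (hT.2 _).2 ⟨_, rfl⟩, rfl⟩

theorem IsLSFor.exists_tail {G : Type*} [Group G] {t : ℕ} {B : Fin (t + 1) → Finset G}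
    {S : Finset G} (h : IsLSFor S B) (hS : S.Nonempty) :
    ∃ T, (IsLSFor T fun i : Fin t => B i.succ) ∧ IsDirectProd (B 0) T S := by
  classical
  obtain ⟨g₀, hg₀⟩ := hS
  obtain ⟨b₀, -⟩ := (h.2 g₀).1 hg₀
  have hcons : ∀ (a : B 0) (c : ∀ i : Fin t, B i.succ),
      lsProd B (Fin.cons (α := fun i => B i) a c) = a * lsProd (fun i : Fin t => B i.succ) c := by
    intro a c
    rw [lsProd_succ]
    rfl
  have hT : ∀ g, g ∈ Finset.univ.image (lsProd fun i : Fin t => B i.succ) ↔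
      ∃ c, lsProd (fun i : Fin t => B i.succ) c = g := by
    simp
  have hinj : ∀ (a a' : B 0) (c c' : ∀ i : Fin t, B i.succ),
      (a : G) * lsProd (fun i : Fin t => B i.succ) c = a' * lsProd (fun i : Fin t => B i.succ) c' →
      a = a' ∧ c = c' := by
    intro a a' c c' e
    rw [← hcons, ← hcons] at e
    exact Fin.cons_injective2 (h.1 e)
  refine ⟨_, ⟨fun c c' e => (hinj (b₀ 0) (b₀ 0) c c' (by rw [e])).2, hT⟩,
    isDirectProd_iff.2 ⟨fun a ha s hs a' ha' s' hs' e => ?_, fun g => ⟨fun hg => ?_, ?_⟩⟩⟩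
  · obtain ⟨c, rfl⟩ := (hT _).1 hs
    obtain ⟨c', rfl⟩ := (hT _).1 hs'
    obtain ⟨e₁, rfl⟩ := hinj ⟨a, ha⟩ ⟨a', ha'⟩ c c' e
    exact ⟨congrArg Subtype.val e₁, rfl⟩
  · obtain ⟨b, rfl⟩ := (h.2 g).1 hg
    exact ⟨b 0, (b 0).2, _, (hT _).2 ⟨_, rfl⟩, (lsProd_succ B b).symm⟩
  · rintro ⟨a, ha, s, hs, rfl⟩
    obtain ⟨c, rfl⟩ := (hT _).1 hs
    exact (h.2 _).2 ⟨_, hcons ⟨a, ha⟩ c⟩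

/-- Signatures of the two factors of a direct product concatenate. -/
theorem IsLSFor.exists_append {G : Type*} [Group G] {u : ℕ} {U : Finset G} {C : Fin u → Finset G}
    (hC : IsLSFor U C) {t : ℕ} {B : Fin t → Finset G} {S R : Finset G} (hB : IsLSFor S B)
    (hR : IsDirectProd S U R) (hS : S.Nonempty) :
    ∃ (n : ℕ) (D : Fin n → Finset G), IsLSFor R D ∧ lsLength D = lsLength B + lsLength C := by
  induction t generalizing S R with
  | zero =>
    obtain rfl := isLSFor_zero.1 hB
    have : R = U := by
      ext g
      simp [(isDirectProd_iff.1 hR).2 g]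
    subst this
    exact ⟨u, C, hC, by simp [lsLength]⟩
  | succ t ih =>
    obtain ⟨T, hT, hd⟩ := hB.exists_tail hS
    have hne : (B 0).Nonempty ∧ T.Nonempty := by
      obtain ⟨g, hg⟩ := hS
      obtain ⟨a, ha, s, hs, -⟩ := ((isDirectProd_iff.1 hd).2 g).1 hg
      exact ⟨⟨a, ha⟩, ⟨s, hs⟩⟩
    obtain ⟨V, hV, hR'⟩ := hd.assoc hR hne.1
    obtain ⟨n, D, hD, hl⟩ := ih hT hV hne.2
    refine ⟨n + 1, Fin.cons (B 0) D, IsLSFor.of_tail (T := V) ?_ ?_, ?_⟩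
    · simpa using hD
    · simpa using hR'
    · rw [lsLength_succ, lsLength_succ B, add_assoc, ← hl]
      simp

theorem lsTarget_one : lsTarget 1 = 0 := by
  simp [lsTarget]

theorem lsTarget_mul {m n : ℕ} (hm : m ≠ 0) (hn : n ≠ 0) :
    lsTarget (m * n) = lsTarget m + lsTarget n := by
  rw [lsTarget, Nat.factorization_mul hm hn]
  exact Finsupp.sum_add_index' (fun _ => zero_mul _) fun _ _ _ => add_mul _ _ _

theorem IsDirectProd.hasMLSFor {G : Type*} [Group G] {A T S : Finset G}
    (h : IsDirectProd A T S) (hS : S.Nonempty) (hA : HasMLSFor A) (hT : HasMLSFor T) :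
    HasMLSFor S := by
  obtain ⟨s, B, hB, hBl⟩ := hA
  obtain ⟨t, C, hC, hCl⟩ := hT
  have hc : A.card * T.card ≠ 0 := h.card ▸ hS.card_ne_zero
  obtain ⟨hA0, hT0⟩ := mul_ne_zero_iff.1 hc
  obtain ⟨n, D, hD, hl⟩ := hC.exists_append hB h (Finset.card_ne_zero.1 hA0)
  exact ⟨n, D, hD, by rw [hl, hBl, hCl, h.card, lsTarget_mul hA0 hT0]⟩

/-- A nonempty set with a logarithmic signature all of whose blocks admit minimal logarithmic
signatures admits a minimal logarithmic signature. -/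
theorem IsLSFor.hasMLSFor {G : Type*} [Group G] {r : ℕ} {A : Fin r → Finset G} {S : Finset G}
    (hA : IsLSFor S A) (hS : S.Nonempty) (hblocks : ∀ j, HasMLSFor (A j)) : HasMLSFor S := by
  induction r generalizing S with
  | zero =>
    exact ⟨0, A, hA, by rw [isLSFor_zero.1 hA]; simp [lsLength, lsTarget_one]⟩
  | succ r ih =>
    obtain ⟨T, hT, hd⟩ := hA.exists_tail hS
    have hne : T.Nonempty := by
      obtain ⟨g, hg⟩ := hS
      obtain ⟨-, -, s, hs, -⟩ := ((isDirectProd_iff.1 hd).2 g).1 hg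
      exact ⟨s, hs⟩
    exact hd.hasMLSFor hS (hblocks 0) (ih hT hne fun j => hblocks j.succ)

/-- if `[A₁, …, A_r]` is a logarithmic signature for `G` and each block
`Aⱼ` admits a minimal logarithmic signature as a subset of `G`, then `G` admits a
minimal logarithmic signature. -/
theorem hasMLS_of_ls_blocks {G : Type*} [Group G] [Finite G] {r : ℕ}
    (A : Fin r → Finset G) (hA : IsLS A) (hblocks : ∀ j, HasMLSFor (A j)) :
    HasMLS G := by
  have := Fintype.ofFinite G
  have hU : IsLSFor Finset.univ A := ⟨hA.1, fun g => by simpa using hA.2 g⟩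
  obtain ⟨t, B, hB, hl⟩ := hU.hasMLSFor ⟨1, Finset.mem_univ 1⟩ hblocks
  refine ⟨t, B, ⟨hB.1, fun g => (hB.2 g).1 (Finset.mem_univ g)⟩, ?_⟩
  rw [hl, Finset.card_univ, Nat.card_eq_fintype_card]
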